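/- Let A be a p×p real symmetric matrix whose eigenvalue of largest absolute value is nonzero and simple in absolute value, let y be a unit eigenvector for this eigenvalue, and let γ < 1 be the ratio of the second largest to the largest eigenvalue of A in absolute value. If x is a unit vector with yᵀx > 0 and Ax ≠ 0, then x' = Ax/‖Ax‖ satisfies |yᵀx'| ≥ |yᵀx| · [1 + (1-γ²)(1-(yᵀx)²)/2]. -/

import Mathlib

namespace TPaper

noncomputable def nrm2 {p : ℕ} (x : Fin p → ℝ) : ℝ := Real.sqrt (∑ i, x i ^ 2)

def dotp {p : ℕ} (x y : Fin p → ℝ) : ℝ := ∑ i, x i * y i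

noncomputable def supp {p : ℕ} (x : Fin p → ℝ) : Finset (Fin p) :=
  Finset.univ.filter fun i => x i ≠ 0

def subm {p : ℕ} (A : Matrix (Fin p) (Fin p) ℝ) (F : Finset (Fin p)) :
    Matrix {i // i ∈ F} {i // i ∈ F} ℝ :=
  A.submatrix Subtype.val Subtype.val

noncomputable def specNorm {n : Type*} [Fintype n] [DecidableEq n]
    (B : Matrix n n ℝ) : ℝ :=
  sSup {r : ℝ | ∃ μ ∈ spectrum ℝ B, r = |μ|}

noncomputable def rhoRes {p : ℕ} (E : Matrix (Fin p) (Fin p) ℝ) (s : ℕ) : ℝ :=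
  sSup {r : ℝ | ∃ F : Finset (Fin p), F.card = s ∧ r = specNorm (subm E F)}

def Trunc {p : ℕ} (x : Fin p → ℝ) (F : Finset (Fin p)) : Fin p → ℝ :=
  fun i => if i ∈ F then x i else 0

def IsTopK {p : ℕ} (y : Fin p → ℝ) (k : ℕ) (F : Finset (Fin p)) : Prop :=
  F.card = k ∧ ∀ i ∈ F, ∀ j ∉ F, |y j| ≤ |y i|

noncomputable def maxEig {n : Type*} [Fintype n] [DecidableEq n]
    (B : Matrix n n ℝ) : ℝ :=
  sSup (spectrum ℝ B)

noncomputable def eigList {n : Type*} [Fintype n] [DecidableEq n] {B : Matrix n n ℝ}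
    (hB : B.IsHermitian) : List ℝ :=
  ((Finset.univ.val.map hB.eigenvalues).sort (· ≤ ·)).reverse

theorem nrm2_sq {p : ℕ} (x : Fin p → ℝ) : nrm2 x ^ 2 = dotp x x := by
  rw [nrm2, Real.sq_sqrt (Finset.sum_nonneg fun i _ => sq_nonneg _), dotp]
  exact Finset.sum_congr rfl fun i _ => sq (x i)

theorem dotp_smul {p : ℕ} (a : ℝ) (x y : Fin p → ℝ) : dotp x (a • y) = a * dotp x y :=
  dotProduct_smul a x y

/-- The coordinates of a vector in the eigenvector basis of a Hermitian matrix. -/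
noncomputable def eigenCoord {p : ℕ} {A : Matrix (Fin p) (Fin p) ℝ} (hA : A.IsHermitian)
    (v : Fin p → ℝ) (j : Fin p) : ℝ :=
  dotp (hA.eigenvectorBasis j).ofLp v

theorem eigenCoord_mulVec {p : ℕ} {A : Matrix (Fin p) (Fin p) ℝ} (hA : A.IsHermitian)
    (v : Fin p → ℝ) (j : Fin p) :
    eigenCoord hA (A.mulVec v) j = hA.eigenvalues j * eigenCoord hA v j := by
  have hT : A.transpose = A := by simpa using hA.eq
  change (hA.eigenvectorBasis j).ofLp ⬝ᵥ A.mulVec v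
    = hA.eigenvalues j * ((hA.eigenvectorBasis j).ofLp ⬝ᵥ v)
  rw [Matrix.dotProduct_mulVec, ← Matrix.mulVec_transpose, hT, hA.mulVec_eigenvectorBasis,
    smul_dotProduct, smul_eq_mul]

theorem dotp_eq_sum_eigenCoord {p : ℕ} {A : Matrix (Fin p) (Fin p) ℝ} (hA : A.IsHermitian)
    (u v : Fin p → ℝ) : dotp u v = ∑ j, eigenCoord hA u j * eigenCoord hA v j := by
  have h := hA.eigenvectorBasis.sum_inner_mul_inner (WithLp.toLp 2 u) (WithLp.toLp 2 v)
  simp only [EuclideanSpace.inner_eq_star_dotProduct, star_trivial] at h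
  rw [dotProduct_comm] at h
  refine h.symm.trans (Finset.sum_congr rfl fun j _ => ?_)
  rw [dotProduct_comm v]
  rfl

/-- An eigenvector has no coordinates along basis eigenvectors for other eigenvalues. -/
theorem eigenCoord_eq_zero {p : ℕ} {A : Matrix (Fin p) (Fin p) ℝ} (hA : A.IsHermitian)
    {lam : ℝ} {y : Fin p → ℝ} (hy : A.mulVec y = lam • y) {j : Fin p}
    (hj : hA.eigenvalues j ≠ lam) : eigenCoord hA y j = 0 := by
  have h := eigenCoord_mulVec hA y j
  rw [hy, eigenCoord, dotp_smul] at h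
  exact (mul_eq_mul_right_iff.mp h).resolve_left hj.symm

/-- Contraction of the component orthogonal to the dominant eigenvector. -/
theorem dotp_mulVec_self_le {p : ℕ} {A : Matrix (Fin p) (Fin p) ℝ} (hA : A.IsHermitian)
    {lam r : ℝ} {i0 : Fin p} (hi0 : hA.eigenvalues i0 = lam) (hr : r < |lam|)
    (hbound : ∀ j, j ≠ i0 → |hA.eigenvalues j| ≤ r)
    {y : Fin p → ℝ} (hy : A.mulVec y = lam • y) (hyn : dotp y y = 1) (x : Fin p → ℝ) :
    dotp (A.mulVec x) (A.mulVec x) ≤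
      lam ^ 2 * dotp y x ^ 2 + r ^ 2 * (dotp x x - dotp y x ^ 2) := by
  have hzero : ∀ j, j ≠ i0 → eigenCoord hA y j = 0 := fun j hj =>
    eigenCoord_eq_zero hA hy fun h => by
      have := hbound j hj
      rw [h] at this
      linarith
  have hsum : ∀ v, dotp y v = eigenCoord hA y i0 * eigenCoord hA v i0 := fun v => by
    rw [dotp_eq_sum_eigenCoord hA]
    exact Finset.sum_eq_single i0 (fun j _ hj => by rw [hzero j hj, zero_mul]) (by simp)
  have hsq : dotp y x ^ 2 = eigenCoord hA x i0 ^ 2 := by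
    rw [hsum] at hyn
    rw [hsum, mul_pow, sq (eigenCoord hA y i0), hyn, one_mul]
  rw [hsq, dotp_eq_sum_eigenCoord hA x x, dotp_eq_sum_eigenCoord hA (A.mulVec x),
    ← Finset.add_sum_erase _ _ (Finset.mem_univ i0),
    ← Finset.add_sum_erase _ (fun j => eigenCoord hA x j * eigenCoord hA x j)
      (Finset.mem_univ i0)]
  have hle : ∑ j ∈ Finset.univ.erase i0,
      eigenCoord hA (A.mulVec x) j * eigenCoord hA (A.mulVec x) j ≤
      r ^ 2 * ∑ j ∈ Finset.univ.erase i0, eigenCoord hA x j * eigenCoord hA x j := by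
    rw [Finset.mul_sum]
    refine Finset.sum_le_sum fun j hj => ?_
    have h := pow_le_pow_left₀ (abs_nonneg _) (hbound j (Finset.ne_of_mem_erase hj)) 2
    rw [sq_abs] at h
    rw [eigenCoord_mulVec]
    nlinarith [mul_le_mul_of_nonneg_right h (mul_self_nonneg (eigenCoord hA x j))]
  rw [eigenCoord_mulVec, hi0]
  linarith

theorem dotp_mulVec_of_eigenvector {p : ℕ} {A : Matrix (Fin p) (Fin p) ℝ} (hA : A.IsHermitian)
    {lam : ℝ} {y : Fin p → ℝ} (hy : A.mulVec y = lam • y) (x : Fin p → ℝ) :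
    dotp y (A.mulVec x) = lam * dotp y x := by
  have hT : A.transpose = A := by simpa using hA.eq
  change y ⬝ᵥ A.mulVec x = lam * (y ⬝ᵥ x)
  rw [Matrix.dotProduct_mulVec, ← Matrix.mulVec_transpose, hT, hy, smul_dotProduct, smul_eq_mul]

theorem dotp_sq_le {p : ℕ} (x y : Fin p → ℝ) : dotp x y ^ 2 ≤ dotp x x * dotp y y := by
  simpa only [dotp, ← sq] using Finset.sum_mul_sq_le_sq_mul_sq Finset.univ x y

theorem one_sub_mul_one_add_half_sq_le {u : ℝ} (hu : 0 ≤ u) :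
    (1 - u) * (1 + u / 2) ^ 2 ≤ 1 := by
  nlinarith [pow_nonneg hu 2, pow_nonneg hu 3]

theorem statement6 (p : ℕ)
    (A : Matrix (Fin p) (Fin p) ℝ) (hA : A.IsHermitian)
    (lam : ℝ) (i0 : Fin p)
    (hi0 : hA.eigenvalues i0 = lam) (hlam : lam ≠ 0)
    (gamma : ℝ) (hglt : gamma < 1)
    (hga : ∀ j, j ≠ i0 → |hA.eigenvalues j| ≤ gamma * |lam|)
    (hgeq : ∃ j, j ≠ i0 ∧ |hA.eigenvalues j| = gamma * |lam|)
    (y : Fin p → ℝ) (hy : A.mulVec y = lam • y) (hyn : nrm2 y = 1)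
    (x : Fin p → ℝ) (hxn : nrm2 x = 1)
    (hyx : 0 < dotp y x) (hAx : A.mulVec x ≠ 0) :
    |dotp y x| * (1 + (1 - gamma ^ 2) * (1 - (dotp y x) ^ 2) / 2) ≤
      |dotp y ((nrm2 (A.mulVec x))⁻¹ • A.mulVec x)| := by
  have hlam' : 0 < |lam| := abs_pos.mpr hlam
  have hg0 : 0 ≤ gamma := by
    obtain ⟨j, -, hj⟩ := hgeq
    exact nonneg_of_mul_nonneg_left (hj ▸ abs_nonneg _) hlam'
  have hyy : dotp y y = 1 := by rw [← nrm2_sq, hyn, one_pow]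
  have hxx : dotp x x = 1 := by rw [← nrm2_sq, hxn, one_pow]
  have hN := dotp_mulVec_self_le hA hi0 (mul_lt_of_lt_one_left hlam' hglt) hga hy hyy x
  have ht := dotp_sq_le y x
  rw [hyy, hxx, one_mul] at ht
  rw [← nrm2_sq, hxx, mul_pow, sq_abs] at hN
  have hNpos : 0 < nrm2 (A.mulVec x) := by
    obtain ⟨i, hi⟩ := Function.ne_iff.mp hAx
    exact Real.sqrt_pos.mpr (Finset.sum_pos' (fun _ _ => sq_nonneg _)
      ⟨i, Finset.mem_univ i, sq_pos_of_ne_zero hi⟩)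
  rw [dotp_smul, dotp_mulVec_of_eigenvector hA hy, abs_mul, abs_mul, abs_inv, abs_of_pos hNpos,
    inv_mul_eq_div, le_div_iff₀ hNpos, mul_assoc, mul_comm |lam|]
  refine mul_le_mul_of_nonneg_left ?_ (abs_nonneg _)
  set u := (1 - gamma ^ 2) * (1 - dotp y x ^ 2) with hu_def
  have hu : 0 ≤ u := mul_nonneg (by nlinarith) (by linarith)
  refine abs_le_of_sq_le_sq' ?_ hlam'.le |>.2
  calc ((1 + u / 2) * nrm2 (A.mulVec x)) ^ 2
      = (1 + u / 2) ^ 2 * nrm2 (A.mulVec x) ^ 2 := mul_pow _ _ _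
    _ ≤ (1 + u / 2) ^ 2 * (lam ^ 2 * (1 - u)) := by
      refine mul_le_mul_of_nonneg_left (hN.trans_eq ?_) (sq_nonneg _)
      rw [hu_def]
      ring
    _ = lam ^ 2 * ((1 - u) * (1 + u / 2) ^ 2) := by ring
    _ ≤ lam ^ 2 := mul_le_of_le_one_right (sq_nonneg _) (one_sub_mul_one_add_half_sq_le hu)
    _ = |lam| ^ 2 := (sq_abs lam).symm

end TPaper
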